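/- arXiv:1808.07260 — 5 statements merged into one kernel-verified Lean document; each statement's English description precedes it below -/
import Mathlib

section
/- Under the LASSO setup with the sign condition and any δ > 0, the empirical scaling value α̂ = (⟨μ̂, y⟩ + δ)/(‖μ̂‖² + δ) satisfies α̂ = 1 + λ‖β̂‖₁/(‖μ̂‖² + δ); in particular α̂ ≥ 1. -/
open Matrix

/-- Under the LASSO setup with the sign condition and any `δ > 0`, the empirical
scaling value `α̂ = (⟨μ̂, y⟩ + δ)/(‖μ̂‖² + δ)` satisfies
`α̂ = 1 + λ‖β̂‖₁/(‖μ̂‖² + δ)`; in particular `α̂ ≥ 1`. -/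
theorem lasso_empirical_scaling_formula
    (n k : ℕ) (hn : 0 < n) (hk : 0 < k) (hkn : k ≤ n)
    (lam : ℝ) (hlam : 0 ≤ lam) (y : Fin n → ℝ)
    (X : Matrix (Fin n) (Fin k) ℝ) (hX : IsUnit (Xᵀ * X)) (S : Fin k → ℝ)
    (beta : Fin k → ℝ) (hbeta : beta = (Xᵀ * X)⁻¹.mulVec (Xᵀ.mulVec y - lam • S))
    (mu : Fin n → ℝ) (hmu : mu = X.mulVec beta)
    (q : Fin n → ℝ) (hq : q = X.mulVec ((Xᵀ * X)⁻¹.mulVec S))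
    (hsign : S ⬝ᵥ beta = ∑ i, |beta i|)
    (δ : ℝ) (hδ : 0 < δ)
    (ahat : ℝ) (hahat : ahat = (mu ⬝ᵥ y + δ) / (mu ⬝ᵥ mu + δ)) :
    ahat = 1 + lam * (∑ i, |beta i|) / (mu ⬝ᵥ mu + δ) ∧ 1 ≤ ahat := by
  have hdet : IsUnit (Xᵀ * X).det := (Matrix.isUnit_iff_isUnit_det _).1 hX
  have hnormal : (Xᵀ * X) *ᵥ beta = Xᵀ *ᵥ y - lam • S := by
    rw [hbeta, Matrix.mulVec_mulVec, Matrix.mul_nonsing_inv _ hdet, Matrix.one_mulVec]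
  have hadj : ∀ v : Fin n → ℝ, mu ⬝ᵥ v = beta ⬝ᵥ (Xᵀ *ᵥ v) := by
    intro v
    rw [hmu, Matrix.dotProduct_mulVec, Matrix.vecMul_transpose]
  have hmm : mu ⬝ᵥ mu = mu ⬝ᵥ y - lam * ∑ i, |beta i| := by
    have h1 : Xᵀ *ᵥ mu = Xᵀ *ᵥ y - lam • S := by
      rw [hmu, Matrix.mulVec_mulVec, hnormal]
    rw [hadj mu, h1, dotProduct_sub, ← hadj y, dotProduct_smul, dotProduct_comm beta S, hsign,
      smul_eq_mul]
  have hnn : 0 ≤ mu ⬝ᵥ mu := Finset.sum_nonneg fun i _ => mul_self_nonneg (mu i)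
  have hpos : 0 < mu ⬝ᵥ mu + δ := by linarith
  have hs : 0 ≤ lam * ∑ i, |beta i| :=
    mul_nonneg hlam (Finset.sum_nonneg fun i _ => abs_nonneg _)
  have key : ahat = 1 + lam * (∑ i, |beta i|) / (mu ⬝ᵥ mu + δ) := by
    rw [hahat, eq_comm, ← div_self hpos.ne', ← add_div]
    congr 1
    linarith
  refine ⟨key, ?_⟩
  rw [key]
  have := div_nonneg hs hpos.le
  linarith
end

section
/- (Property 1) Under the LASSO setup with the sign condition and any δ > 0, letting μ̃ = Ĥy denote the least-squares fit onto the columns of X̂ and α̂ = (⟨μ̂, y⟩ + δ)/(‖μ̂‖² + δ), the residual sums of squares satisfy ‖y − μ̃‖² ≤ ‖y − α̂ μ̂‖² ≤ ‖y − μ̂‖². -/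
open Matrix

/-- Property 1: under the LASSO setup with the sign condition and any `δ > 0`,
with `μ̃ = Ĥy` the least-squares fit and `α̂ = (⟨μ̂, y⟩ + δ)/(‖μ̂‖² + δ)`,
the residual sums of squares satisfy
`‖y − μ̃‖² ≤ ‖y − α̂μ̂‖² ≤ ‖y − μ̂‖²`. -/
theorem lasso_scaled_residual_sandwich
    (n k : ℕ) (hn : 0 < n) (hk : 0 < k) (hkn : k ≤ n)
    (lam : ℝ) (hlam : 0 ≤ lam) (y : Fin n → ℝ)
    (X : Matrix (Fin n) (Fin k) ℝ) (hX : IsUnit (Xᵀ * X)) (S : Fin k → ℝ)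
    (beta : Fin k → ℝ) (hbeta : beta = (Xᵀ * X)⁻¹.mulVec (Xᵀ.mulVec y - lam • S))
    (mu : Fin n → ℝ) (hmu : mu = X.mulVec beta)
    (H : Matrix (Fin n) (Fin n) ℝ) (hH : H = X * (Xᵀ * X)⁻¹ * Xᵀ)
    (q : Fin n → ℝ) (hq : q = X.mulVec ((Xᵀ * X)⁻¹.mulVec S))
    (hsign : S ⬝ᵥ beta = ∑ i, |beta i|)
    (δ : ℝ) (hδ : 0 < δ)
    (ahat : ℝ) (hahat : ahat = (mu ⬝ᵥ y + δ) / (mu ⬝ᵥ mu + δ))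
    (mutilde : Fin n → ℝ) (hmutilde : mutilde = H.mulVec y) :
    (y - mutilde) ⬝ᵥ (y - mutilde) ≤ (y - ahat • mu) ⬝ᵥ (y - ahat • mu)
      ∧ (y - ahat • mu) ⬝ᵥ (y - ahat • mu) ≤ (y - mu) ⬝ᵥ (y - mu) := by
  have hm : 0 ≤ mu ⬝ᵥ mu := by
    simpa using dotProduct_star_self_nonneg mu
  constructor
  · set r := y - mutilde with hr
    have horth : Xᵀ *ᵥ r = 0 := by
      have hdet : IsUnit (Xᵀ * X).det := (Matrix.isUnit_iff_isUnit_det _).1 hX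
      rw [hr, hmutilde, hH, Matrix.mulVec_sub, Matrix.mulVec_mulVec, ← Matrix.mul_assoc,
        ← Matrix.mul_assoc, Matrix.mul_nonsing_inv _ hdet, Matrix.one_mul, sub_self]
    have hw : ∃ v, mutilde - ahat • mu = X *ᵥ v := by
      refine ⟨((Xᵀ * X)⁻¹ * Xᵀ) *ᵥ y - ahat • beta, ?_⟩
      rw [hmutilde, hH, hmu, Matrix.mulVec_sub, Matrix.mulVec_smul, Matrix.mulVec_mulVec,
        Matrix.mul_assoc]
    obtain ⟨v, hv⟩ := hw
    have h0 : r ⬝ᵥ (X *ᵥ v) = 0 := by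
      rw [Matrix.dotProduct_mulVec, ← Matrix.mulVec_transpose, horth, zero_dotProduct]
    have hy : y - ahat • mu = r + X *ᵥ v := by
      rw [← hv, hr]; abel
    have hnn : 0 ≤ (X *ᵥ v) ⬝ᵥ (X *ᵥ v) := by
      simpa using dotProduct_star_self_nonneg (X *ᵥ v)
    rw [hy, add_dotProduct, dotProduct_add, dotProduct_add, dotProduct_comm (X *ᵥ v) r, h0]
    linarith
  · have ha : ahat * (mu ⬝ᵥ mu + δ) = mu ⬝ᵥ y + δ := by
      rw [hahat]; field_simp
    simp only [sub_dotProduct, dotProduct_sub, smul_dotProduct, dotProduct_smul, smul_eq_mul,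
      dotProduct_comm y mu]
    have hp : mu ⬝ᵥ y = ahat * (mu ⬝ᵥ mu + δ) - δ := by linarith
    rw [hp]
    have : 0 ≤ (ahat - 1) ^ 2 * (mu ⬝ᵥ mu + 2 * δ) := by positivity
    nlinarith [this]
end

section
/- (Property 3) Let λ ≥ 0, δ > 0, ρ_min > 0 be reals and n, m positive integers. Let B and α̂ be real random variables on a probability space such that almost surely B > 0, α̂ − 1 ≤ λB/δ, and α̂ − 1 ≤ λm²/(n·ρ_min·B), and such that α̂ is integrable. Then E[α̂ − 1] ≤ max(1/δ, m²/ρ_min) · λ/√n. -/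
open MeasureTheory

/-- Property 3: expected expansion bound for the empirical scaling value. If a.s.
`B > 0`, `α̂ − 1 ≤ λB/δ` and `α̂ − 1 ≤ λm²/(n·ρ_min·B)`, with `α̂` integrable,
then `E[α̂ − 1] ≤ max(1/δ, m²/ρ_min)·λ/√n`. -/
theorem expected_scaling_bound
    (lam δ ρmin : ℝ) (hlam : 0 ≤ lam) (hδ : 0 < δ) (hρmin : 0 < ρmin)
    (n m : ℕ) (hn : 0 < n) (hm : 0 < m)
    {Ω : Type*} [MeasurableSpace Ω] (P : Measure Ω) [IsProbabilityMeasure P]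
    (B ahat : Ω → ℝ)
    (hB : ∀ᵐ ω ∂P, 0 < B ω)
    (h1 : ∀ᵐ ω ∂P, ahat ω - 1 ≤ lam * B ω / δ)
    (h2 : ∀ᵐ ω ∂P, ahat ω - 1 ≤ lam * (m : ℝ) ^ 2 / ((n : ℝ) * ρmin * B ω))
    (hint : Integrable ahat P) :
    ∫ ω, (ahat ω - 1) ∂P ≤ max (1 / δ) ((m : ℝ) ^ 2 / ρmin) * lam / Real.sqrt n := by
  have hn' : (0 : ℝ) < n := by exact_mod_cast hn
  have hs : 0 < Real.sqrt n := Real.sqrt_pos.mpr hn'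
  have hss : Real.sqrt n * Real.sqrt n = n := Real.mul_self_sqrt hn'.le
  have key : ∀ᵐ ω ∂P,
      ahat ω - 1 ≤ max (1 / δ) ((m : ℝ) ^ 2 / ρmin) * lam / Real.sqrt n := by
    filter_upwards [hB, h1, h2] with ω hb ha hc
    rcases le_total (B ω) (1 / Real.sqrt n) with h | h
    · calc ahat ω - 1 ≤ lam * B ω / δ := ha
        _ = (1 / δ) * lam * B ω := by ring
        _ ≤ max (1 / δ) ((m : ℝ) ^ 2 / ρmin) * lam * (1 / Real.sqrt n) := by
          gcongr
          exact le_max_left _ _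
        _ = _ := by ring
    · have h3 : 1 / ((n : ℝ) * B ω) ≤ 1 / Real.sqrt n := by
        apply one_div_le_one_div_of_le hs
        rw [div_le_iff₀ hs] at h
        calc Real.sqrt n = Real.sqrt n * 1 := by ring
          _ ≤ Real.sqrt n * (B ω * Real.sqrt n) := by gcongr
          _ = (Real.sqrt n * Real.sqrt n) * B ω := by ring
          _ = n * B ω := by rw [hss]
      calc ahat ω - 1 ≤ lam * (m : ℝ) ^ 2 / ((n : ℝ) * ρmin * B ω) := hc
        _ = ((m : ℝ) ^ 2 / ρmin) * lam * (1 / ((n : ℝ) * B ω)) := by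
          field_simp
        _ ≤ max (1 / δ) ((m : ℝ) ^ 2 / ρmin) * lam * (1 / Real.sqrt n) := by
          gcongr
          exact le_max_right _ _
        _ = _ := by ring
  calc ∫ ω, (ahat ω - 1) ∂P
      ≤ ∫ _, max (1 / δ) ((m : ℝ) ^ 2 / ρmin) * lam / Real.sqrt n ∂P :=
        integral_mono_ae (hint.sub (integrable_const 1)) (integrable_const _) key
    _ = _ := by simp
end

section
/- Fix δ > 0 and define α̂ : ℝⁿ → ℝ by α̂(y) = (⟨μ̂(y), y⟩ + δ)/(‖μ̂(y)‖² + δ), where μ̂(y) = Ĥy − λq̂ is the locally-affine LASSO map. Then for every y ∈ ℝⁿ, the inner product of μ̂(y) with the gradient of α̂ at y equals (1 − α̂(y)) · (‖μ̂(y)‖² − δ)/(‖μ̂(y)‖² + δ). -/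
open Matrix

/-- For the locally-affine LASSO map `μ̂(y) = Ĥy − λq̂` and `δ > 0`, with
`α̂(y) = (⟨μ̂(y), y⟩ + δ)/(‖μ̂(y)‖² + δ)`, the inner product of `μ̂(y)` with the
gradient (the vector of partial derivatives) of `α̂` at `y` equals
`(1 − α̂(y))·(‖μ̂(y)‖² − δ)/(‖μ̂(y)‖² + δ)`. -/
theorem lasso_mu_dot_gradient_alpha
    (n k : ℕ) (hn : 0 < n) (hk : 0 < k) (hkn : k ≤ n) (lam : ℝ)
    (X : Matrix (Fin n) (Fin k) ℝ) (hX : IsUnit (Xᵀ * X)) (S : Fin k → ℝ)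
    (H : Matrix (Fin n) (Fin n) ℝ) (hH : H = X * (Xᵀ * X)⁻¹ * Xᵀ)
    (q : Fin n → ℝ) (hq : q = X.mulVec ((Xᵀ * X)⁻¹.mulVec S))
    (mu : (Fin n → ℝ) → (Fin n → ℝ)) (hmu : ∀ y, mu y = H.mulVec y - lam • q)
    (δ : ℝ) (hδ : 0 < δ)
    (ahat : (Fin n → ℝ) → ℝ)
    (hahat : ∀ y, ahat y = ((∑ i, mu y i * y i) + δ) / ((∑ i, (mu y i) ^ 2) + δ)) :
    ∀ y : Fin n → ℝ,
      ∑ i, mu y i * fderiv ℝ ahat y (Pi.single i 1)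
        = (1 - ahat y) * ((∑ i, (mu y i) ^ 2) - δ) / ((∑ i, (mu y i) ^ 2) + δ) := by
  intro y
  have hH2 : H * X = X := by
    have hd : IsUnit (Xᵀ * X).det := (Matrix.isUnit_iff_isUnit_det _).1 hX
    rw [hH, Matrix.mul_assoc, Matrix.mul_assoc, Matrix.nonsing_inv_mul _ hd, Matrix.mul_one]
  have hHq : H.mulVec q = q := by
    rw [hq, Matrix.mulVec_mulVec, hH2]
  have hHH : H * H = H := by
    nth_rewrite 2 [hH]
    rw [← Matrix.mul_assoc, ← Matrix.mul_assoc, hH2, ← hH]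
  have hHv : H.mulVec (mu y) = mu y := by
    rw [hmu, Matrix.mulVec_sub, Matrix.mulVec_smul, hHq, Matrix.mulVec_mulVec, hHH]
  have hline : ∀ t : ℝ, mu (y + t • mu y) = (1 + t) • mu y := by
    intro t
    rw [hmu (y + t • mu y), Matrix.mulVec_add, Matrix.mulVec_smul, hHv, add_smul, one_smul]
    nth_rewrite 2 [hmu y]
    abel
  have hpos : ∀ z, (∑ i, (mu z i) ^ 2) + δ ≠ 0 := fun z =>
    (add_pos_of_nonneg_of_pos (Finset.sum_nonneg fun i _ => sq_nonneg _) hδ).ne'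
  have hmud : ∀ i, Differentiable ℝ (fun z => mu z i) := by
    intro i
    have : (fun z => mu z i) = fun z => (∑ j, H i j * z j) - lam * q i := by
      funext z
      rw [hmu]
      simp [Matrix.mulVec, dotProduct]
    rw [this]
    fun_prop
  have hdiff : DifferentiableAt ℝ ahat y := by
    have : ahat = fun z => ((∑ i, mu z i * z i) + δ) / ((∑ i, (mu z i) ^ 2) + δ) :=
      funext hahat
    rw [this]
    have d1 : DifferentiableAt ℝ (fun z => (∑ i, mu z i * z i) + δ) y := by fun_prop
    have d2 : DifferentiableAt ℝ (fun z => (∑ i, (mu z i) ^ 2) + δ) y := by fun_prop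
    simp only [div_eq_mul_inv]
    exact d1.fun_mul (d2.fun_inv (hpos y))
  have hsum : ∑ i, mu y i * fderiv ℝ ahat y (Pi.single i 1) = fderiv ℝ ahat y (mu y) := by
    conv_rhs => rw [pi_eq_sum_univ' (mu y)]
    rw [map_sum]
    refine Finset.sum_congr rfl fun i _ => ?_
    rw [map_smul, smul_eq_mul]
  have h1 : HasDerivAt (fun t : ℝ => ahat (y + t • mu y)) (fderiv ℝ ahat y (mu y)) 0 :=
    hdiff.hasFDerivAt.hasLineDerivAt (mu y)
  have hp := hpos y
  have hay := hahat y
  set s := ∑ i, (mu y i) ^ 2 with hs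
  set a := ∑ i, mu y i * y i with ha
  have hfun : (fun t : ℝ => ahat (y + t • mu y)) =
      fun t => ((1 + t) * (a + t * s) + δ) / ((1 + t) ^ 2 * s + δ) := by
    funext t
    rw [hahat, hline]
    congr 2
    · rw [ha, hs, Finset.mul_sum, ← Finset.sum_add_distrib, Finset.mul_sum]
      refine Finset.sum_congr rfl fun i _ => ?_
      simp only [Pi.smul_apply, Pi.add_apply, smul_eq_mul]
      ring
    · rw [hs, Finset.mul_sum]
      refine Finset.sum_congr rfl fun i _ => ?_
      simp only [Pi.smul_apply, smul_eq_mul]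
      ring
  have e1 : HasDerivAt (fun t : ℝ => 1 + t) 1 0 := (hasDerivAt_id (0 : ℝ)).const_add 1
  have e2 : HasDerivAt (fun t : ℝ => a + t * s) (1 * s) 0 :=
    ((hasDerivAt_id (0 : ℝ)).mul_const s).const_add a
  have h2 := ((e1.fun_mul e2).add_const δ).fun_div (((e1.fun_pow 2).mul_const s).add_const δ)
    (by simpa using hp)
  rw [hfun] at h1
  rw [hsum, h1.unique h2, hay]
  norm_num
  field_simp
  ring
end

section
/- (Divergence computation underlying Theorem 1) Fix δ > 0 and define α̂ : ℝⁿ → ℝ by α̂(y) = (⟨μ̂(y), y⟩ + δ)/(‖μ̂(y)‖² + δ), where μ̂(y) = Ĥy − λq̂ is the locally-affine LASSO map. Then the scaled-LASSO map F : ℝⁿ → ℝⁿ, F(y) = α̂(y)·μ̂(y), is differentiable, and its divergence (the trace of its Jacobian matrix) at every y equals d̂₁ + d̂₂, where d̂₁ = (1 − α̂(y))·(‖μ̂(y)‖² − δ)/(‖μ̂(y)‖² + δ) and d̂₂ = α̂(y)·k, k being the number of columns of X̂ (which equals the trace of Ĥ). -/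
open Matrix

/-- Divergence computation underlying Theorem 1: for the locally-affine LASSO
map `μ̂(y) = Ĥy − λq̂`, `δ > 0` and `α̂(y) = (⟨μ̂(y), y⟩ + δ)/(‖μ̂(y)‖² + δ)`,
the scaled-LASSO map `F(y) = α̂(y)·μ̂(y)` is differentiable and its divergence
(the trace of its Jacobian, i.e. `∑ᵢ ∂Fᵢ/∂yᵢ`) at every `y` equals
`d̂₁ + d̂₂` with `d̂₁ = (1 − α̂(y))(‖μ̂(y)‖² − δ)/(‖μ̂(y)‖² + δ)` and
`d̂₂ = α̂(y)·k`. -/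
theorem lasso_scaled_divergence
    (n k : ℕ) (hn : 0 < n) (hk : 0 < k) (hkn : k ≤ n) (lam : ℝ)
    (X : Matrix (Fin n) (Fin k) ℝ) (hX : IsUnit (Xᵀ * X)) (S : Fin k → ℝ)
    (H : Matrix (Fin n) (Fin n) ℝ) (hH : H = X * (Xᵀ * X)⁻¹ * Xᵀ)
    (q : Fin n → ℝ) (hq : q = X.mulVec ((Xᵀ * X)⁻¹.mulVec S))
    (mu : (Fin n → ℝ) → (Fin n → ℝ)) (hmu : ∀ y, mu y = H.mulVec y - lam • q)
    (δ : ℝ) (hδ : 0 < δ)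
    (ahat : (Fin n → ℝ) → ℝ)
    (hahat : ∀ y, ahat y = ((∑ i, mu y i * y i) + δ) / ((∑ i, (mu y i) ^ 2) + δ))
    (F : (Fin n → ℝ) → (Fin n → ℝ)) (hF : ∀ y, F y = ahat y • mu y) :
    Differentiable ℝ F ∧
      ∀ y : Fin n → ℝ,
        ∑ i, fderiv ℝ F y (Pi.single i 1) i
          = (1 - ahat y) * ((∑ i, (mu y i) ^ 2) - δ) / ((∑ i, (mu y i) ^ 2) + δ)
            + ahat y * k := by
  have hdet : IsUnit (Xᵀ * X).det := (Matrix.isUnit_iff_isUnit_det _).1 hX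
  have hHX : H * X = X := by
    rw [hH, Matrix.mul_assoc, Matrix.mul_assoc, Matrix.nonsing_inv_mul _ hdet, Matrix.mul_one]
  have hHH : H * H = H := by
    conv_lhs => rw [hH]
    rw [← hH]
    conv_lhs => rhs; rw [hH]
    rw [← Matrix.mul_assoc, ← Matrix.mul_assoc, hHX, ← hH]
  have htr : ∑ i, H i i = (k : ℝ) := by
    have : H.trace = (k : ℝ) := by
      rw [hH, Matrix.trace_mul_comm, ← Matrix.mul_assoc, Matrix.mul_nonsing_inv _ hdet]
      simp
    simpa [Matrix.trace] using this
  have hHq : H.mulVec q = q := by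
    rw [hq, Matrix.mulVec_mulVec, hHX]
  have hHm : ∀ y, H.mulVec (mu y) = mu y := by
    intro y
    rw [hmu, Matrix.mulVec_sub, Matrix.mulVec_smul, hHq, Matrix.mulVec_mulVec, hHH]
  let L : (Fin n → ℝ) →L[ℝ] (Fin n → ℝ) := LinearMap.toContinuousLinearMap (Matrix.mulVecLin H)
  have hL : ∀ v, L v = H.mulVec v := fun v => rfl
  have hmud : ∀ y, HasFDerivAt mu L y := by
    intro y
    have : mu = fun y => L y - lam • q := by
      funext y; rw [hmu, hL]
    rw [this]
    exact L.hasFDerivAt.sub_const _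
  have hmui : ∀ y i, HasFDerivAt (fun y => mu y i)
      ((ContinuousLinearMap.proj (R := ℝ) (φ := fun _ : Fin n => ℝ) i).comp L) y := by
    intro y i
    exact (hasFDerivAt_pi'.1 (hmud y)) i
  have hyi : ∀ (y : Fin n → ℝ) i, HasFDerivAt (fun y : Fin n → ℝ => y i)
      (ContinuousLinearMap.proj (R := ℝ) (φ := fun _ : Fin n => ℝ) i) y := by
    intro y i
    exact (ContinuousLinearMap.proj (R := ℝ) (φ := fun _ : Fin n => ℝ) i).hasFDerivAt
  have hD : ∀ y, 0 < (∑ i, (mu y i) ^ 2) + δ := fun y => by positivity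
  have hA : ∀ y, ∃ A : (Fin n → ℝ) →L[ℝ] ℝ, HasFDerivAt ahat A y ∧
      A (mu y) = (1 - ahat y) * ((∑ i, (mu y i) ^ 2) - δ) / ((∑ i, (mu y i) ^ 2) + δ) := by
    intro y
    have h1 := (HasFDerivAt.fun_sum (u := Finset.univ)
      (fun i _ => (hmui y i).mul (hyi y i))).add_const δ
    have h2 := (HasFDerivAt.fun_sum (u := Finset.univ)
      (fun i _ => (hmui y i).mul (hmui y i))).add_const δ
    have hD' : (∑ i, mu y i * mu y i) + δ ≠ 0 := by
      have := (hD y).ne'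
      simpa only [pow_two] using this
    have h3 := h1.mul ((hasDerivAt_inv hD').comp_hasFDerivAt y h2)
    have h4 : ahat = fun y => ((∑ i, mu y i * y i) + δ) * ((∑ i, mu y i * mu y i) + δ)⁻¹ := by
      funext y
      rw [hahat, div_eq_mul_inv]
      simp only [pow_two]
    refine ⟨_, by rw [h4]; exact h3, ?_⟩
    simp only [pow_two, hahat]
    simp [hL, hHm, Finset.sum_add_distrib]
    rw [show ∑ i, y i * mu y i = ∑ i, mu y i * y i from
      Finset.sum_congr rfl fun i _ => mul_comm _ _]
    generalize (∑ i, mu y i * mu y i) = s at *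
    generalize (∑ i, mu y i * y i) = p at *
    field_simp
    ring
  have hFd : ∀ y (A : (Fin n → ℝ) →L[ℝ] ℝ), HasFDerivAt ahat A y →
      HasFDerivAt F (ahat y • L + A.smulRight (mu y)) y := by
    intro y A h
    have : F = fun y => ahat y • mu y := funext hF
    rw [this]
    exact h.smul (hmud y)
  refine ⟨fun y => ?_, fun y => ?_⟩
  · obtain ⟨A, h, -⟩ := hA y
    exact (hFd y A h).differentiableAt
  · obtain ⟨A, h, hAm⟩ := hA y
    rw [(hFd y A h).fderiv, ← hAm, ← htr]
    have hs : A (mu y) = ∑ i, A (Pi.single i 1) * mu y i := by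
      conv_lhs => rw [pi_eq_sum_univ' (mu y)]
      rw [map_sum]
      refine Finset.sum_congr rfl fun i _ => ?_
      rw [map_smul, smul_eq_mul, mul_comm]
    rw [hs, Finset.mul_sum, ← Finset.sum_add_distrib]
    refine Finset.sum_congr rfl fun i _ => ?_
    simp [hL, add_comm]
end
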